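/- arXiv:1404.6263 — 2 statements merged into one kernel-verified Lean document; each statement's English description precedes it below -/
import Mathlib

section
/- Let (A,α) be an Eilenberg-Moore algebra for the Kalmbach monad, let C ∈ T(A) be an even-length chain, and let u be an upper bound of C with u ∉ C. Then α(C Δ [0<u]) = α([α(C) < u]) (where for C = ∅ the right-hand side is read using α(∅) = 0). -/
attribute [local instance] Classical.propDecidable

universe u v w

/- Kalmbach extension machinery, parameterized by an explicit order relation. -/



/-- `C` is a finite chain with an even number of elements w.r.t. the order `r`. -/
def IsEvenChainR {α : Type u} (r : α → α → Prop) (C : Finset α) : Prop :=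
  (∀ a ∈ C, ∀ b ∈ C, r a b ∨ r b a) ∧ Even C.card

/-- `(a, b)` is one of the consecutive pairs `(x_{2i-1}, x_{2i})` of the even chain
`C = [x₁ < x₂ < … < x_{2n}]`: both belong to `C`, `a` occupies an odd position
(the number of elements of `C` below `a` is odd) and `b` is the immediate successor
of `a` in `C`. -/
def KalPairR {α : Type u} (r : α → α → Prop) (C : Finset α) (a b : α) : Prop :=
  a ∈ C ∧ b ∈ C ∧ r a b ∧ a ≠ b ∧
    Odd (C.filter fun y => r y a).card ∧
    (∀ c ∈ C, r a c → c ≠ a → r b c)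

/-- The Kalmbach order: `[x₁<x₂<…<x_{2n}] ≤ [y₁<y₂<…<y_{2k}]` iff for every `i`
there is `j` with `y_{2j-1} ≤ x_{2i-1} < x_{2i} ≤ y_{2j}`. -/
def KalLER {α : Type u} (r : α → α → Prop) (C D : Finset α) : Prop :=
  ∀ a b, KalPairR r C a b → ∃ c d, KalPairR r D c d ∧ r c a ∧ r b d

/-- The carrier of the Kalmbach extension `K(P)`: all finite chains with an even
number of elements (with elements taken from the carrier `S`). -/
def KalCarrier {α : Type u} (S : Set α) (r : α → α → Prop) : Set (Finset α) :=
  {C | ↑C ⊆ S ∧ IsEvenChainR r C}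

/-- Orthocomplementation on the Kalmbach extension: `C ↦ C Δ {0, 1}`. -/
noncomputable def kalComplF {α : Type u} (z u : α) (C : Finset α) : Finset α :=
  symmDiff C {z, u}

/-- The unit `η` of the Kalmbach adjunction: `η(0) = ∅` and `η(a) = [0 < a]` for `a > 0`. -/
noncomputable def kalEtaF {α : Type u} (z : α) (a : α) : Finset α :=
  if a = z then ∅ else {z, a}

/-- Symmetric difference of a finite family of finite sets:
`Δᵢ Cᵢ = {x | x belongs to an odd number of the Cᵢ}`. -/
noncomputable def kalMuF {α : Type u} (𝒞 : Finset (Finset α)) : Finset α :=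
  (𝒞.sup id).filter fun x => Odd (𝒞.filter fun C => x ∈ C).card

/-- `K(f)(C) = Δ_{x ∈ C} {f x}`, i.e. the set of `y` such that the number of
elements of `C` mapped to `y` is odd. -/
noncomputable def kalMapF {α : Type u} {β : Type v} (f : α → β) (C : Finset α) : Finset β :=
  (C.image f).filter fun y => Odd (C.filter fun x => f x = y).card

/-- Enumerate a finite chain in increasing order (w.r.t. `r`) as a list. -/
noncomputable def chainSortR {α : Type u} (r : α → α → Prop) (C : Finset α) : List α :=
  C.toList.mergeSort fun a b => decide (r a b)

/-- An Eilenberg-Moore algebra for the Kalmbach monad: a bounded poset `P` together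
with a bounded-poset morphism `m : T P → P` (monotone, preserving bottom `∅` and top
`{⊥,⊤}`) satisfying the unit law `m ∘ η = id` and the multiplication law
`m ∘ T m = m ∘ μ`. -/
def IsEMAlgebra (P : Type u) [PartialOrder P] [BoundedOrder P] (m : Finset P → P) : Prop :=
  (∀ C ∈ KalCarrier Set.univ ((· ≤ ·) : P → P → Prop),
     ∀ D ∈ KalCarrier Set.univ ((· ≤ ·) : P → P → Prop),
       KalLER (· ≤ ·) C D → m C ≤ m D) ∧
  m ∅ = ⊥ ∧ m ({⊥, ⊤} : Finset P) = ⊤ ∧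
  (∀ a : P, m (kalEtaF ⊥ a) = a) ∧
  (∀ 𝒞 : Finset (Finset P),
     𝒞 ∈ KalCarrier (KalCarrier Set.univ ((· ≤ ·) : P → P → Prop))
           (KalLER ((· ≤ ·) : P → P → Prop)) →
       m (kalMapF m 𝒞) = m (kalMuF 𝒞))

/-- The two-element chain `[x < y]`, read as the symmetric difference `{x} Δ {y}`
(so it degenerates to `∅` when `x = y`). -/
noncomputable def sdPair {α : Type u} (x y : α) : Finset α :=
  if x = y then ∅ else {x, y}

/-- Let `(P, m)` be an Eilenberg-Moore algebra for the Kalmbach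
monad, `C` an even chain in `P` and `u` an upper bound of `C` with `u ∉ C`.  Then
`m (C Δ [0 < u]) = m [m C < u]` (where for `C = ∅` the right-hand side is read
using `m ∅ = 0`). -/
theorem EM_algebra_aux_symmDiff_eta
    (P : Type u) [PartialOrder P] [BoundedOrder P] [Nontrivial P]
    (m : Finset P → P) (hm : IsEMAlgebra P m)
    (C : Finset P) (hC : C ∈ KalCarrier Set.univ ((· ≤ ·) : P → P → Prop))
    (u : P) (hu : ∀ x ∈ C, x ≤ u) (huC : u ∉ C) :
    m (symmDiff C (kalEtaF ⊥ u)) = m (sdPair (m C) u) := by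
  obtain ⟨-, hbot, -, heta, hmu⟩ := hm
  by_cases hu0 : u = ⊥
  · have hCe : C = ∅ := by
      apply Finset.eq_empty_of_forall_notMem
      intro x hx
      have h1 := hu x hx
      rw [hu0, le_bot_iff] at h1
      exact huC (by rw [hu0, ← h1]; exact hx)
    subst hCe
    subst hu0
    simp [kalEtaF, sdPair, hbot]
  have hb : (⊥ : P) ≠ u := fun h => hu0 h.symm
  have hE : kalEtaF ⊥ u = ({⊥, u} : Finset P) := by simp [kalEtaF, hu0]
  have hmE : m {⊥, u} = u := by rw [← hE]; exact heta u
  rw [hE]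
  set E : Finset P := {⊥, u} with hEdef
  have hCE : C ≠ E := by
    rintro rfl
    exact huC (by simp [hEdef])
  have hEC : E ∈ KalCarrier Set.univ ((· ≤ ·) : P → P → Prop) := by
    refine ⟨Set.subset_univ _, ?_, ?_⟩
    · intro a ha b hb'
      simp only [hEdef, Finset.mem_insert, Finset.mem_singleton] at ha hb'
      rcases ha with rfl | rfl
      · exact Or.inl bot_le
      · rcases hb' with rfl | rfl
        · exact Or.inr bot_le
        · exact Or.inl le_rfl
    · rw [hEdef, Finset.card_pair hb]; exact even_two
  have hrefl : ∀ D : Finset P, KalLER ((· ≤ ·) : P → P → Prop) D D :=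
    fun D a b h => ⟨a, b, h, le_rfl, le_rfl⟩
  have hle : KalLER ((· ≤ ·) : P → P → Prop) C E := by
    intro a b h
    refine ⟨⊥, u, ⟨by simp [hEdef], by simp [hEdef], bot_le, hb, ?_, ?_⟩, bot_le, hu b h.2.1⟩
    · have : (E.filter fun y => y ≤ ⊥) = {⊥} := by
        ext y
        simp only [hEdef, Finset.mem_filter, Finset.mem_insert, Finset.mem_singleton, le_bot_iff]
        tauto
      rw [this]; simp
    · intro c hc _ hcb
      simp only [hEdef, Finset.mem_insert, Finset.mem_singleton] at hc
      rcases hc with rfl | rfl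
      · exact absurd rfl hcb
      · exact le_rfl
  have key := hmu {C, E} (by
    refine ⟨?_, ?_, ?_⟩
    · intro D hD
      simp only [Finset.coe_insert, Finset.coe_singleton, Set.mem_insert_iff,
        Set.mem_singleton_iff] at hD
      rcases hD with rfl | rfl
      · exact hC
      · exact hEC
    · intro a ha b hb'
      simp only [Finset.mem_insert, Finset.mem_singleton] at ha hb'
      rcases ha with rfl | rfl <;> rcases hb' with rfl | rfl
      · exact Or.inl (hrefl _)
      · exact Or.inl hle
      · exact Or.inr hle
      · exact Or.inl (hrefl _)
    · rw [Finset.card_pair hCE]; exact even_two)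
  have h1 : kalMuF {C, E} = symmDiff C E := by
    ext x
    simp only [kalMuF, Finset.mem_filter, Finset.mem_symmDiff, Finset.filter_insert,
      Finset.filter_singleton]
    by_cases h1 : x ∈ C <;> by_cases h2 : x ∈ E <;> simp [h1, h2, hCE, Finset.card_pair]
  have h2 : kalMapF m {C, E} = sdPair (m C) u := by
    ext y
    rw [kalMapF, Finset.mem_filter]
    simp only [sdPair, Finset.filter_insert,
      Finset.filter_singleton, Finset.image_insert, Finset.image_singleton, hmE,
      Finset.mem_insert, Finset.mem_singleton]
    by_cases h0 : m C = u
    · by_cases h3 : u = y <;> simp [h0, h3, hCE]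
    · by_cases h3 : m C = y
      · subst h3
        simp [h0, Ne.symm h0]
      · by_cases h4 : u = y
        · subst h4
          simp [h0]
        · simp [h0, h3, h4, Ne.symm h3, Ne.symm h4]
  rw [← h1, ← key, h2]
end

section
/- Let (A,α) be an Eilenberg-Moore algebra for the Kalmbach monad. Then for every even-length chain [x₁<x₂<…<x_{2k}] in A, α([x₁<x₂<…<x_{2k}]) = (x₂⊖x₁) ⊕ (x₄⊖x₃) ⊕ … ⊕ (x_{2k}⊖x_{2k-1}), where ⊖ and ⊕ are the operations of the effect algebra E(A,α) determined by b⊖a = α([a<b]) for a<b; consequently the structure map α is uniquely determined by the induced effect algebra structure. -/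
attribute [local instance] Classical.propDecidable

universe u v w

/-- The difference operation of an Eilenberg-Moore algebra `(P, m)`:
`b ⊖ a = 0` if `a = b`, and `b ⊖ a = m [a < b]` if `a < b` (junk otherwise;
its intended domain is `a ≤ b`). -/
noncomputable def emSub {P : Type u} [PartialOrder P] [BoundedOrder P]
    (m : Finset P → P) (b a : P) : P :=
  if a = b then ⊥ else m {a, b}

/-- The partial sum of the effect algebra `E(P, m)` induced by an Eilenberg-Moore
algebra `(P, m)`: `a ⊕ b = 1 ⊖ ((1 ⊖ a) ⊖ b)` (defined when `a ≤ 1 ⊖ b`). -/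
noncomputable def emAdd {P : Type u} [PartialOrder P] [BoundedOrder P]
    (m : Finset P → P) (a b : P) : P :=
  emSub m ⊤ (emSub m (emSub m ⊤ a) b)

/-- `(x₂ ⊖ x₁) ⊕ (x₄ ⊖ x₃) ⊕ …` for a list `[x₁, x₂, …]`, computed with the
operations of the effect algebra induced by an Eilenberg-Moore algebra `(P, m)`. -/
noncomputable def emSumList {P : Type u} [PartialOrder P] [BoundedOrder P]
    (m : Finset P → P) : List P → P
  | [] => ⊥
  | [_] => ⊥
  | a :: b :: l => emAdd m (emSub m b a) (emSumList m l)

section KalAux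

variable {P : Type u} [PartialOrder P] [BoundedOrder P]

lemma kal_mu_pair {α : Type u} (C D : Finset α) (h : C ≠ D) :
    kalMuF ({C, D} : Finset (Finset α)) = symmDiff C D := by
  ext x
  simp only [kalMuF, Finset.mem_filter, Finset.mem_symmDiff]
  by_cases h1 : x ∈ C <;> by_cases h2 : x ∈ D <;>
    simp [Finset.filter_insert, Finset.filter_singleton, h1, h2, h, Finset.card_pair h]

lemma kal_map_pair (m : Finset P → P) (C D : Finset P) (h : C ≠ D) :
    kalMapF m ({C, D} : Finset (Finset P)) = if m C = m D then ∅ else {m C, m D} := by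
  ext x
  simp only [kalMapF, Finset.mem_filter]
  by_cases h1 : m C = x <;> by_cases h2 : m D = x
  · simp [Finset.filter_insert, Finset.filter_singleton, h1, h2, Finset.card_pair h]
  · have : ¬ x = m D := fun e => h2 e.symm
    simp [Finset.filter_insert, Finset.filter_singleton, h1, h2, this]
  · have : ¬ m C = m D := fun e => h1 (e.trans h2)
    simp [Finset.filter_insert, Finset.filter_singleton, h1, h2]
  · have a1 : ¬ x = m D := fun e => h2 e.symm
    have a2 : ¬ x = m C := fun e => h1 e.symm
    split_ifs <;> simp [a1, a2]

lemma kal_sub (m : Finset P → P) (hm : IsEMAlgebra P m) (C D : Finset P)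
    (hC : C ∈ KalCarrier Set.univ ((· ≤ ·) : P → P → Prop))
    (hD : D ∈ KalCarrier Set.univ ((· ≤ ·) : P → P → Prop))
    (h : KalLER (· ≤ ·) C D) : m (symmDiff C D) = emSub m (m D) (m C) := by
  obtain ⟨-, h0, -, -, hmu⟩ := hm
  by_cases e : C = D
  · subst e
    simp [emSub, h0]
  · have hr : ∀ E : Finset P, KalLER ((· ≤ ·) : P → P → Prop) E E :=
      fun E a b hab => ⟨a, b, hab, le_rfl, le_rfl⟩
    have := hmu {C, D} ⟨by
      intro E hE
      simp only [Finset.coe_insert, Finset.coe_singleton, Set.mem_insert_iff,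
        Set.mem_singleton_iff] at hE
      rcases hE with rfl | rfl <;> assumption, by
      intro A hA B hB
      simp only [Finset.mem_insert, Finset.mem_singleton] at hA hB
      rcases hA with rfl | rfl <;> rcases hB with rfl | rfl <;> simp [hr, h], by
      rw [Finset.card_pair e]; exact even_two⟩
    rw [kal_mu_pair _ _ e, kal_map_pair _ _ _ e] at this
    rw [← this, emSub]
    split_ifs <;> simp [h0]

lemma kal_symm_even {α : Type u} (C D : Finset α) (hC : Even C.card) (hD : Even D.card) :
    Even (symmDiff C D).card := by
  have h1 : (symmDiff C D).card = (C \ D).card + (D \ C).card := by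
    rw [symmDiff_def, Finset.sup_eq_union, Finset.card_union_of_disjoint disjoint_sdiff_sdiff]
  have h2 := Finset.card_sdiff_add_card_inter C D
  have h3 := Finset.card_sdiff_add_card_inter D C
  rw [Finset.inter_comm] at h3
  rw [h1]
  grind

lemma kal_symm_carrier (C D : Finset P) (hC : Even C.card) (hD : Even D.card)
    (h : ∀ a ∈ C ∪ D, ∀ b ∈ C ∪ D, a ≤ b ∨ b ≤ a) :
    symmDiff C D ∈ KalCarrier Set.univ ((· ≤ ·) : P → P → Prop) := by
  refine ⟨Set.subset_univ _, ?_, kal_symm_even C D hC hD⟩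
  intro a ha b hb
  apply h
  · rw [Finset.mem_symmDiff] at ha; rw [Finset.mem_union]; tauto
  · rw [Finset.mem_symmDiff] at hb; rw [Finset.mem_union]; tauto

lemma kal_le_top [Nontrivial P] (C : Finset P) :
    KalLER ((· ≤ ·) : P → P → Prop) C {⊥, ⊤} := by
  intro a b _
  refine ⟨⊥, ⊤, ⟨by simp, by simp, bot_le, bot_ne_top, ?_, ?_⟩, bot_le, le_top⟩
  · simp [Finset.filter_insert, Finset.filter_singleton]
  · intro c hc _ h
    simp only [Finset.mem_insert, Finset.mem_singleton] at hc
    rcases hc with rfl | rfl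
    · exact absurd rfl h
    · exact le_rfl

lemma kal_le_compl [Nontrivial P] (x y : P) (hxy : x < y) (C : Finset P)
    (hC : ∀ c ∈ C, y < c) :
    KalLER ((· ≤ ·) : P → P → Prop) C (symmDiff {x, y} {⊥, ⊤}) := by
  intro a b hab
  have hya := hC a hab.1
  have hyt : y < ⊤ := lt_of_lt_of_le hya le_top
  have hyb : ⊥ < y := lt_of_le_of_lt bot_le hxy
  have hxt : x < ⊤ := hxy.trans hyt
  refine ⟨y, ⊤, ⟨?_, ?_, le_top, hyt.ne, ?_, ?_⟩, hya.le, le_top⟩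
  · simp [Finset.mem_symmDiff, hyt.ne, hyb.ne']
  · simp [Finset.mem_symmDiff, hyt.ne', hxt.ne']
  · by_cases hx : x = ⊥
    · have : (symmDiff ({x, y} : Finset P) {⊥, ⊤}).filter (fun z => z ≤ y) = {y} := by
        ext z
        simp only [Finset.mem_filter, Finset.mem_symmDiff, Finset.mem_insert,
          Finset.mem_singleton]
        constructor
        · rintro ⟨h, hz⟩
          have : z ≠ ⊤ := fun e => absurd hyt (by rw [← e]; exact fun h => absurd hz h.not_ge)
          subst hx
          tauto
        · rintro rfl
          exact ⟨Or.inl ⟨Or.inr rfl, by simp [hyt.ne, hyb.ne']⟩, le_rfl⟩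
      rw [this]; simp
    · have : (symmDiff ({x, y} : Finset P) {⊥, ⊤}).filter (fun z => z ≤ y) = {⊥, x, y} := by
        ext z
        simp only [Finset.mem_filter, Finset.mem_symmDiff, Finset.mem_insert,
          Finset.mem_singleton]
        constructor
        · rintro ⟨h, hz⟩
          have : z ≠ ⊤ := fun e => absurd hyt (by rw [← e]; exact fun h => absurd hz h.not_ge)
          tauto
        · rintro (rfl | rfl | rfl)
          · exact ⟨Or.inr ⟨Or.inl rfl, by simp [hyb.ne, Ne.symm hx]⟩, bot_le⟩
          · exact ⟨Or.inl ⟨Or.inl rfl, by simp [hxt.ne, hx]⟩, hxy.le⟩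
          · exact ⟨Or.inl ⟨Or.inr rfl, by simp [hyt.ne, hyb.ne']⟩, le_rfl⟩
      rw [this, Finset.card_eq_three.2 ⟨⊥, x, y, Ne.symm hx, hyb.ne, hxy.ne, rfl⟩]
      decide
  · intro c hc hle hne
    simp only [Finset.mem_symmDiff, Finset.mem_insert, Finset.mem_singleton] at hc
    rcases hc with ⟨rfl | rfl, _⟩ | ⟨rfl | rfl, _⟩
    · exact absurd hxy hle.not_gt
    · exact absurd rfl hne
    · exact absurd hyb hle.not_gt
    · exact le_rfl

lemma kal_step [Nontrivial P] (m : Finset P → P) (hm : IsEMAlgebra P m) (x y : P) (hxy : x < y)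
    (C : Finset P) (hC : C ∈ KalCarrier Set.univ ((· ≤ ·) : P → P → Prop))
    (hy : ∀ c ∈ C, y < c) :
    m (insert x (insert y C)) = emAdd m (m {x, y}) (m C) ∧
      m C ≤ emSub m ⊤ (m {x, y}) := by
  have htop := hm.2.2.1
  have ht : ({⊥, ⊤} : Finset P) ∈ KalCarrier Set.univ ((· ≤ ·) : P → P → Prop) := by
    refine ⟨Set.subset_univ _, ?_, by rw [Finset.card_pair bot_ne_top]; exact even_two⟩
    intro a ha b hb
    simp only [Finset.mem_insert, Finset.mem_singleton] at ha hb
    rcases ha with rfl | rfl <;> simp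
  have hp : ({x, y} : Finset P) ∈ KalCarrier Set.univ ((· ≤ ·) : P → P → Prop) := by
    refine ⟨Set.subset_univ _, ?_, by rw [Finset.card_pair hxy.ne]; exact even_two⟩
    intro a ha b hb
    simp only [Finset.mem_insert, Finset.mem_singleton] at ha hb
    rcases ha with rfl | rfl <;> rcases hb with rfl | rfl <;> simp [hxy.le]
  have hcompl : ∀ D ∈ KalCarrier Set.univ ((· ≤ ·) : P → P → Prop),
      symmDiff D {⊥, ⊤} ∈ KalCarrier Set.univ ((· ≤ ·) : P → P → Prop) := by
    intro D hD
    apply kal_symm_carrier _ _ hD.2.2 ht.2.2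
    intro a ha b hb
    simp only [Finset.mem_union, Finset.mem_insert, Finset.mem_singleton] at ha hb
    rcases ha with ha | rfl | rfl
    · rcases hb with hb | rfl | rfl
      · exact hD.2.1 a ha b hb
      · simp
      · simp
    · simp
    · simp
  have hx : ∀ c ∈ C, x < c := fun c hc => hxy.trans (hy c hc)
  have hins : insert x (insert y C) = symmDiff {x, y} C := by
    ext z
    have h1 : z ∈ C → z ≠ x := fun h => (hx z h).ne'
    have h2 : z ∈ C → z ≠ y := fun h => (hy z h).ne'
    simp only [Finset.mem_symmDiff, Finset.mem_insert, Finset.mem_singleton]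
    tauto
  have hE : symmDiff {x, y} C ∈ KalCarrier Set.univ ((· ≤ ·) : P → P → Prop) := by
    apply kal_symm_carrier _ _ hp.2.2 hC.2.2
    intro a ha b hb
    simp only [Finset.mem_union] at ha hb
    have key : ∀ u ∈ ({x, y} : Finset P), ∀ c ∈ C, u ≤ c := by
      intro u hu c hc
      simp only [Finset.mem_insert, Finset.mem_singleton] at hu
      rcases hu with rfl | rfl
      · exact (hx c hc).le
      · exact (hy c hc).le
    rcases ha with ha | ha <;> rcases hb with hb | hb
    · exact hp.2.1 a ha b hb
    · exact Or.inl (key a ha b hb)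
    · exact Or.inr (key b hb a ha)
    · exact hC.2.1 a ha b hb
  have e1 := kal_sub m hm _ _ hp ht (kal_le_top _)
  rw [htop] at e1
  have hle := kal_le_compl x y hxy C hy
  have e2 := kal_sub m hm _ _ hC (hcompl _ hp) hle
  have e3 := kal_sub m hm _ _ (hcompl _ hE) ht (kal_le_top _)
  rw [htop, symmDiff_symmDiff_cancel_right] at e3
  have e4 : symmDiff C (symmDiff {x, y} {⊥, ⊤}) = symmDiff (symmDiff {x, y} C) {⊥, ⊤} := by
    rw [← symmDiff_assoc, symmDiff_comm C]
  rw [e4, e1] at e2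
  refine ⟨?_, ?_⟩
  · rw [hins, e3, e2, emAdd]
  · rw [← e1]
    exact hm.1 _ hC _ (hcompl _ hp) hle

lemma kal_list_carrier (l : List P) (hl : l.Pairwise (· < ·)) (he : Even l.length) :
    l.toFinset ∈ KalCarrier Set.univ ((· ≤ ·) : P → P → Prop) := by
  refine ⟨Set.subset_univ _, ?_, ?_⟩
  · intro a ha b hb
    rw [List.mem_toFinset] at ha hb
    by_contra hcon
    rw [not_or] at hcon
    have hl' : l.Pairwise (fun a b => a ≤ b ∨ b ≤ a) := hl.imp fun h => Or.inl h.le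
    haveI : Std.Symm (fun a b : P => a ≤ b ∨ b ≤ a) := ⟨fun _ _ h => h.symm⟩
    have := List.Pairwise.forall_of_forall (R := fun a b : P => a ≤ b ∨ b ≤ a) (fun x _ => Or.inl le_rfl) hl' ha hb
    tauto
  · rw [List.toFinset_card_of_nodup (hl.imp fun h => h.ne)]
    exact he

lemma kal_list_formula [Nontrivial P] (m : Finset P → P) (hm : IsEMAlgebra P m) :
    ∀ l : List P, l.Pairwise (· < ·) → Even l.length → m l.toFinset = emSumList m l
  | [], _, _ => by simp [emSumList, hm.2.1]
  | [_], _, he => by simp at he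
  | a :: b :: l, hl, he => by
    rw [List.pairwise_cons, List.pairwise_cons] at hl
    obtain ⟨h1, h2, h3⟩ := hl
    have he' : Even l.length := by
      simp only [List.length_cons] at he; grind
    have hab : a < b := h1 b (by simp)
    have ih := kal_list_formula m hm l h3 he'
    have := (kal_step m hm a b hab l.toFinset (kal_list_carrier l h3 he')
      (fun c hc => h2 c (List.mem_toFinset.1 hc))).1
    rw [List.toFinset_cons, List.toFinset_cons, this, ih, emSumList]
    rw [emSub.eq_1 m b a, if_neg hab.ne]

lemma kal_list_unique [Nontrivial P] (m m' : Finset P → P) (hm : IsEMAlgebra P m)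
    (hm' : IsEMAlgebra P m') (h : ∀ a b : P, a < b → m' {a, b} = m {a, b}) :
    ∀ l : List P, l.Pairwise (· < ·) → Even l.length → m' l.toFinset = m l.toFinset
  | [], _, _ => by simp [hm.2.1, hm'.2.1]
  | [_], _, he => by simp at he
  | a :: b :: l, hl, he => by
    rw [List.pairwise_cons, List.pairwise_cons] at hl
    obtain ⟨h1, h2, h3⟩ := hl
    have he' : Even l.length := by
      simp only [List.length_cons] at he; grind
    have hab : a < b := h1 b (by simp)
    have ih := kal_list_unique m m' hm hm' h l h3 he'
    have s1 := kal_step m hm a b hab l.toFinset (kal_list_carrier l h3 he')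
      (fun c hc => h2 c (List.mem_toFinset.1 hc))
    have s2 := kal_step m' hm' a b hab l.toFinset (kal_list_carrier l h3 he')
      (fun c hc => h2 c (List.mem_toFinset.1 hc))
    have hs : ∀ c d : P, c ≤ d → emSub m' d c = emSub m d c := by
      intro c d hcd
      unfold emSub
      split_ifs with e
      · rfl
      · exact h c d (lt_of_le_of_ne hcd e)
    rw [List.toFinset_cons, List.toFinset_cons, s1.1, s2.1, ih, h a b hab]
    unfold emAdd
    rw [hs _ ⊤ le_top, hs _ ⊤ le_top, hs _ _ s1.2]

lemma kal_sort (C : Finset P) (hC : C ∈ KalCarrier Set.univ ((· ≤ ·) : P → P → Prop)) :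
    (chainSortR ((· ≤ ·) : P → P → Prop) C).Pairwise (· < ·) ∧
    Even (chainSortR ((· ≤ ·) : P → P → Prop) C).length ∧
    (chainSortR ((· ≤ ·) : P → P → Prop) C).toFinset = C := by
  obtain ⟨s, hs, hrs⟩ := extend_partialOrder ((· ≤ ·) : P → P → Prop)
  have hperm : (chainSortR ((· ≤ ·) : P → P → Prop) C).Perm C.toList :=
    List.mergeSort_perm _ _
  have hiff : ∀ a ∈ C, ∀ b ∈ C, (a ≤ b ↔ s a b) := by
    intro a ha b hb
    refine ⟨fun h => hrs a b h, fun h => ?_⟩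
    rcases hC.2.1 a ha b hb with h' | h'
    · exact h'
    · exact (antisymm_of s h (hrs b a h')).le
  have heq : chainSortR ((· ≤ ·) : P → P → Prop) C
      = C.toList.mergeSort fun a b => decide (s a b) := by
    have := List.map_mergeSort (r := fun a b : P => decide (a ≤ b))
      (s := fun a b => decide (s a b)) (f := id) (l := C.toList) (by
        intro a ha b hb
        simp only [id, decide_eq_decide]
        exact hiff a (Finset.mem_toList.1 ha) b (Finset.mem_toList.1 hb))
    simpa [chainSortR] using this
  have hsort : (chainSortR ((· ≤ ·) : P → P → Prop) C).Pairwise s := by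
    rw [heq]
    have := List.pairwise_mergeSort (le := fun a b => decide (s a b))
      (by simpa using fun a b c h1 h2 => trans_of s h1 h2)
      (by simpa using fun a b => total_of s a b) C.toList
    simpa using this
  have hnd : (chainSortR ((· ≤ ·) : P → P → Prop) C).Nodup :=
    hperm.nodup_iff.2 C.nodup_toList
  have hmem : ∀ a, a ∈ chainSortR ((· ≤ ·) : P → P → Prop) C ↔ a ∈ C := by
    intro a; rw [hperm.mem_iff, Finset.mem_toList]
  refine ⟨?_, ?_, ?_⟩
  · refine List.Pairwise.imp_of_mem ?_ (hsort.and hnd)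
    intro a b ha hb h
    exact lt_of_le_of_ne ((hiff a ((hmem a).1 ha) b ((hmem b).1 hb)).2 h.1) h.2
  · rw [hperm.length_eq, Finset.length_toList]
    exact hC.2.2
  · ext a; rw [List.mem_toFinset, hmem]

end KalAux

/-- Let `(P, m)` be an Eilenberg-Moore algebra for the Kalmbach
monad.  Then for every even chain `[x₁ < x₂ < … < x_{2k}]`,
`m [x₁<…<x_{2k}] = (x₂ ⊖ x₁) ⊕ … ⊕ (x_{2k} ⊖ x_{2k-1})`, computed in the induced
effect algebra `E(P, m)`; consequently the structure map `m` is uniquely determined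
by the induced effect algebra structure (i.e. by its values on two-element chains). -/
theorem EM_algebra_structure_map_determined
    (P : Type u) [PartialOrder P] [BoundedOrder P] [Nontrivial P]
    (m : Finset P → P) (hm : IsEMAlgebra P m) :
    (∀ C ∈ KalCarrier Set.univ ((· ≤ ·) : P → P → Prop),
        m C = emSumList m (chainSortR ((· ≤ ·) : P → P → Prop) C)) ∧
    (∀ m' : Finset P → P, IsEMAlgebra P m' →
        (∀ a b : P, a < b → m' {a, b} = m {a, b}) →
        ∀ C ∈ KalCarrier Set.univ ((· ≤ ·) : P → P → Prop), m' C = m C) := by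
  refine ⟨?_, ?_⟩
  · intro C hC
    obtain ⟨h1, h2, h3⟩ := kal_sort C hC
    have := kal_list_formula m hm _ h1 h2
    rwa [h3] at this
  · intro m' hm' h C hC
    obtain ⟨h1, h2, h3⟩ := kal_sort C hC
    have := kal_list_unique m m' hm hm' h _ h1 h2
    rwa [h3] at this
end
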